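/- Let m and n be positive integers with m even, let A be an m×n matrix and X an n×n matrix over a commutative ring, and let J denote the n×n all-ones matrix. Then det(A·(X + J − Xᵗ)·Aᵗ) = det(A·(X − Xᵗ)·Aᵗ) = (f_A(X))², where f_A(X) = Σ_{I,J⊆[n], |I|=|J|=m/2} det(X_{I,J}) · det(Aᴵ Aᴶ). -/

import Mathlib

open Matrix

/-- Strictly increasing functions `Fin k → Fin n`; these encode the `k`-element
subsets of `{1,…,n}` listed in increasing order. -/
def incrFuns (k n : ℕ) : Finset (Fin k → Fin n) :=
  Finset.univ.filter fun f => ∀ a b : Fin k, a < b → f a < f b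

/-- The `2k × 2k` matrix `(Aᴵ Bᴶ)` obtained by concatenating the columns of `A`
indexed by `fI` with the columns of `B` indexed by `fJ`. -/
def concatCB {R : Type*} [CommRing R] {k n : ℕ} (A B : Matrix (Fin (2*k)) (Fin n) R)
    (fI fJ : Fin k → Fin n) : Matrix (Fin (2*k)) (Fin (2*k)) R :=
  Matrix.of fun i j =>
    if h : (j:ℕ) < k then A i (fI ⟨j, h⟩) else B i (fJ ⟨(j:ℕ) - k, by have := j.isLt; omega⟩)

/-- `f_{A,B}(X) = Σ_{I,J⊆[n], |I|=|J|=m/2} det(X_{I,J}) · det(Aᴵ Bᴶ)`. -/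
def fAB {R : Type*} [CommRing R] {k n : ℕ} (A B : Matrix (Fin (2*k)) (Fin n) R)
    (X : Matrix (Fin n) (Fin n) R) : R :=
  ∑ fI ∈ incrFuns k n, ∑ fJ ∈ incrFuns k n,
    (X.submatrix fI fJ).det * (concatCB A B fI fJ).det

/-- The all-ones matrix `𝒥`. -/
def allOnes (R : Type*) [CommRing R] (n : ℕ) : Matrix (Fin n) (Fin n) R :=
  Matrix.of fun _ _ => 1


open Finset in
/-- Polarized Pfaffian-type sum. -/
def hh {K : Type*} [CommRing K] {k : ℕ} (Ys : Fin k → Matrix (Fin k ⊕ Fin k) (Fin k ⊕ Fin k) K) : K :=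
  ∑ σ : Equiv.Perm (Fin k ⊕ Fin k), ((Equiv.Perm.sign σ : ℤ) : K) *
    ∏ a, Ys a (σ (Sum.inl a)) (σ (Sum.inr a))

lemma hh_update_sub {K : Type*} [CommRing K] {k : ℕ}
    (Ys : Fin k → Matrix (Fin k ⊕ Fin k) (Fin k ⊕ Fin k) K) (a : Fin k)
    (U V : Matrix (Fin k ⊕ Fin k) (Fin k ⊕ Fin k) K) :
    hh (Function.update Ys a (U - V)) =
      hh (Function.update Ys a U) - hh (Function.update Ys a V) := by
  unfold hh
  rw [← Finset.sum_sub_distrib]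
  refine Finset.sum_congr rfl fun σ _ => ?_
  rw [← mul_sub]
  congr 1
  rw [← Finset.mul_prod_erase _ _ (Finset.mem_univ a), ← Finset.mul_prod_erase _ _ (Finset.mem_univ a),
    ← Finset.mul_prod_erase _ _ (Finset.mem_univ a)]
  have key : ∀ W : Matrix (Fin k ⊕ Fin k) (Fin k ⊕ Fin k) K,
      ∏ x ∈ Finset.univ.erase a, Function.update Ys a W x (σ (Sum.inl x)) (σ (Sum.inr x)) =
      ∏ x ∈ Finset.univ.erase a, Ys x (σ (Sum.inl x)) (σ (Sum.inr x)) := by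
    intro W
    refine Finset.prod_congr rfl fun x hx => ?_
    rw [Function.update_of_ne (Finset.ne_of_mem_erase hx)]
  rw [key, key, key]
  simp [sub_mul]

lemma hh_update_transpose {K : Type*} [CommRing K] {k : ℕ}
    (Ys : Fin k → Matrix (Fin k ⊕ Fin k) (Fin k ⊕ Fin k) K) (a : Fin k)
    (U : Matrix (Fin k ⊕ Fin k) (Fin k ⊕ Fin k) K) :
    hh (Function.update Ys a Uᵀ) = - hh (Function.update Ys a U) := by
  unfold hh
  rw [← Finset.sum_neg_distrib]
  rw [← Equiv.sum_comp (Equiv.mulRight (Equiv.swap (Sum.inl a : Fin k ⊕ Fin k) (Sum.inr a)))]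
  refine Finset.sum_congr rfl fun σ _ => ?_
  have hne : (Sum.inl a : Fin k ⊕ Fin k) ≠ Sum.inr a := by simp
  simp only [Equiv.coe_mulRight, Equiv.Perm.sign_mul, Equiv.Perm.sign_swap hne]
  push_cast
  rw [mul_neg_one, neg_mul]
  congr 2
  refine Finset.prod_congr rfl fun x _ => ?_
  by_cases hx : x = a
  · subst hx
    simp
  · have h1 : (Sum.inl x : Fin k ⊕ Fin k) ≠ Sum.inl a := by simpa using hx
    have h2 : (Sum.inr x : Fin k ⊕ Fin k) ≠ Sum.inr a := by simpa using hx
    rw [Function.update_of_ne hx, Function.update_of_ne hx]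
    simp [Equiv.swap_apply_of_ne_of_ne, hx]

lemma hh_anti {K : Type*} [CommRing K] {k : ℕ}
    (Y : Matrix (Fin k ⊕ Fin k) (Fin k ⊕ Fin k) K) :
    hh (fun _ : Fin k => Y - Yᵀ) = 2 ^ k * hh (fun _ : Fin k => Y) := by
  have key : ∀ T : Finset (Fin k), hh (fun a : Fin k => if a ∈ T then Y - Yᵀ else Y) =
      2 ^ T.card * hh (fun _ : Fin k => Y) := by
    intro T
    induction T using Finset.induction_on with
    | empty => simp
    | insert a T ha ih =>
      have e1 : (fun b : Fin k => if b ∈ insert a T then Y - Yᵀ else Y) =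
          Function.update (fun b : Fin k => if b ∈ T then Y - Yᵀ else Y) a (Y - Yᵀ) := by
        funext b
        by_cases hb : b = a
        · subst hb; simp
        · simp [hb]
      have e2 : Function.update (fun b : Fin k => if b ∈ T then Y - Yᵀ else Y) a Y =
          (fun b : Fin k => if b ∈ T then Y - Yᵀ else Y) := by
        rw [Function.update_eq_self_iff]; simp [ha]
      rw [e1, hh_update_sub, hh_update_transpose, e2, ih, Finset.card_insert_of_notMem ha]
      ring
  simpa using key Finset.univ

lemma hh_expand {K : Type*} [CommRing K] {k : ℕ} {ν : Type*} [Fintype ν] [DecidableEq ν]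
    (A : Matrix (Fin k ⊕ Fin k) ν K) (X : Matrix ν ν K) :
    hh (fun _ : Fin k => A * X * Aᵀ) =
      ∑ p : Fin k → ν, ∑ q : Fin k → ν, (∏ a, X (p a) (q a)) *
        (A.submatrix id (Sum.elim p q)).det := by
  have e : ∀ i j, (A * X * Aᵀ) i j = ∑ r, ∑ s, A i r * X r s * A j s := by
    intro i j
    simp only [Matrix.mul_apply, Matrix.transpose_apply, Finset.sum_mul]
    rw [Finset.sum_comm]
  unfold hh
  simp only [e, Finset.prod_univ_sum, Fintype.piFinset_univ, Finset.mul_sum, Matrix.det_apply']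
  rw [Finset.sum_comm]
  refine Finset.sum_congr rfl fun p _ => ?_
  rw [Finset.sum_comm]
  refine Finset.sum_congr rfl fun q _ => ?_
  refine Finset.sum_congr rfl fun σ _ => ?_
  simp only [Fintype.prod_sum_type, Matrix.submatrix_apply, Sum.elim_inl, Sum.elim_inr, id,
    Finset.prod_mul_distrib]
  ring

lemma hh_conj {K : Type*} [CommRing K] {k : ℕ}
    (P Y : Matrix (Fin k ⊕ Fin k) (Fin k ⊕ Fin k) K) :
    hh (fun _ : Fin k => P * Y * Pᵀ) = P.det * hh (fun _ : Fin k => Y) := by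
  have h1 := hh_expand (1 : Matrix (Fin k ⊕ Fin k) (Fin k ⊕ Fin k) K) Y
  rw [Matrix.one_mul, Matrix.transpose_one, Matrix.mul_one] at h1
  rw [h1, hh_expand, Finset.mul_sum]
  refine Finset.sum_congr rfl fun p _ => ?_
  rw [Finset.mul_sum]
  refine Finset.sum_congr rfl fun q _ => ?_
  have : P.submatrix id (Sum.elim p q) =
      P * (1 : Matrix (Fin k ⊕ Fin k) (Fin k ⊕ Fin k) K).submatrix id (Sum.elim p q) := by
    ext i j
    simp [Matrix.mul_apply, Matrix.one_apply]
  rw [this, Matrix.det_mul]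
  ring

/-- The standard half. -/
def EE (K : Type*) [CommRing K] (k : ℕ) : Matrix (Fin k ⊕ Fin k) (Fin k ⊕ Fin k) K :=
  Matrix.fromBlocks 0 1 0 0

lemma hh_EE {K : Type*} [CommRing K] {k : ℕ} :
    hh (fun _ : Fin k => EE K k) = (k.factorial : K) := by
  have : ∑ τ : Equiv.Perm (Fin k), (1 : K) = (k.factorial : K) := by
    simp [Fintype.card_perm]
  rw [← this, eq_comm]
  unfold hh
  refine Finset.sum_of_injOn (fun τ => Equiv.Perm.sumCongr τ τ) ?_ ?_ ?_ ?_
  · intro τ _ τ' _ h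
    ext a : 1
    have := congrArg (fun s : Equiv.Perm (Fin k ⊕ Fin k) => s (Sum.inl a)) h
    simpa using this
  · intro _ _; simp
  · intro σ _ hσ
    by_contra hne
    apply hσ
    have hprod : ∀ a, ∃ b, σ (Sum.inl a) = Sum.inl b ∧ σ (Sum.inr a) = Sum.inr b := by
      intro a
      by_contra hcon
      apply hne
      rw [Finset.prod_eq_zero (Finset.mem_univ a), mul_zero]
      rcases h1 : σ (Sum.inl a) with b | b <;> rcases h2 : σ (Sum.inr a) with c | c <;>
        simp only [EE, Matrix.fromBlocks_apply₁₁, Matrix.fromBlocks_apply₁₂,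
          Matrix.fromBlocks_apply₂₁, Matrix.fromBlocks_apply₂₂, Matrix.zero_apply]
      rw [Matrix.one_apply_ne]
      rintro rfl
      exact hcon ⟨_, h1, h2⟩
    choose t ht1 ht2 using hprod
    have tinj : Function.Injective t := by
      intro a b hab
      have : σ (Sum.inl a) = σ (Sum.inl b) := by rw [ht1, ht1, hab]
      simpa using this
    refine ⟨Equiv.ofBijective t (Finite.injective_iff_bijective.mp tinj), by simp, ?_⟩
    ext x : 1
    rcases x with a | a
    · simp [ht1]
    · simp [ht2]
  · intro τ _
    simp [EE, Equiv.Perm.sign_sumCongr]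

lemma exists_symp {K : Type*} [Field K] (k : ℕ) : ∀ {V : Type _} [AddCommGroup V] [Module K V]
    [FiniteDimensional K V] (B : V →ₗ[K] V →ₗ[K] K) (_ : ∀ x, B x x = 0)
    (_ : ∀ x, (∀ y, B x y = 0) → x = 0) (_ : 2 * k ≤ Module.finrank K V),
    ∃ e f : Fin k → V, (∀ i j, B (e i) (e j) = 0) ∧ (∀ i j, B (f i) (f j) = 0) ∧
      (∀ i j, B (e i) (f j) = if i = j then 1 else 0) := by
  induction k with
  | zero =>
    intro V _ _ _ B _ _ _
    exact ⟨Fin.elim0, Fin.elim0, fun i => i.elim0, fun i => i.elim0, fun i => i.elim0⟩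
  | succ k ih =>
    intro V _ _ _ B halt hnd hrank
    have hskew : ∀ x y, B x y = - B y x := by
      intro x y
      have := halt (x + y)
      simp only [map_add, LinearMap.add_apply, halt] at this
      linear_combination this
    have : 0 < Module.finrank K V := by omega
    have : Nontrivial V := Module.finrank_pos_iff.mp this
    obtain ⟨v, hv⟩ := exists_ne (0 : V)
    obtain ⟨w0, hw0⟩ : ∃ y, B v y ≠ 0 := by
      by_contra hcon
      push Not at hcon
      exact hv (hnd v hcon)
    obtain ⟨w, hw⟩ : ∃ w, B v w = 1 := ⟨(B v w0)⁻¹ • w0, by simp [hw0]⟩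
    have hwv : B w v = -1 := by rw [hskew, hw]
    let φ : V →ₗ[K] K × K := (B v).prod (B w)
    let W : Submodule K V := LinearMap.ker φ
    have hW : ∀ x, x ∈ W ↔ B v x = 0 ∧ B w x = 0 := by
      intro x
      simp [W, φ, LinearMap.mem_ker]
    have hrk : 2 * k ≤ Module.finrank K W := by
      have h1 := LinearMap.finrank_range_add_finrank_ker φ
      have h2 : Module.finrank K (LinearMap.range φ) ≤ Module.finrank K (K × K) :=
        Submodule.finrank_le _
      rw [Module.finrank_prod, Module.finrank_self] at h2
      change _ + Module.finrank K W = _ at h1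
      omega
    let B' : W →ₗ[K] W →ₗ[K] K := B.domRestrict₁₂ W W
    have hB' : ∀ x y : W, B' x y = B x y := fun x y => rfl
    obtain ⟨e, f, he, hf, hef⟩ := ih B' (fun x => halt x) (by
      intro x hx
      have hxW := (hW x).1 x.2
      apply Subtype.ext
      apply hnd
      intro y
      have hy : y + B w y • v - B v y • w ∈ W := by
        rw [hW]
        simp only [map_add, map_sub, map_smul, halt, hw, hwv, smul_eq_mul]
        constructor <;> ring
      have h3 := hx ⟨_, hy⟩
      rw [hB'] at h3
      simp only [map_add, map_sub, map_smul, smul_eq_mul] at h3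
      rw [hskew x v, hskew x w, hxW.1, hxW.2] at h3
      simpa using h3) hrk
    have hv' : ∀ x : W, B v x = 0 := fun x => ((hW x).1 x.2).1
    have hw' : ∀ x : W, B w x = 0 := fun x => ((hW x).1 x.2).2
    have hv'' : ∀ x : W, B x v = 0 := fun x => by rw [hskew, hv', neg_zero]
    have hw'' : ∀ x : W, B x w = 0 := fun x => by rw [hskew, hw', neg_zero]
    simp only [hB'] at he hf hef
    refine ⟨Fin.cons v (fun i => e i), Fin.cons w (fun i => f i), ?_, ?_, ?_⟩
    · intro i j
      refine Fin.cases ?_ (fun i => ?_) i <;> refine Fin.cases ?_ (fun j => ?_) j <;>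
        simp [halt, hv', hv'', he]
    · intro i j
      refine Fin.cases ?_ (fun i => ?_) i <;> refine Fin.cases ?_ (fun j => ?_) j <;>
        simp [halt, hw', hw'', hf]
    · intro i j
      refine Fin.cases ?_ (fun i => ?_) i <;> refine Fin.cases ?_ (fun j => ?_) j <;>
        simp [hw, hw'', hv', hef, Fin.succ_ne_zero, (Fin.succ_ne_zero _).symm]

lemma exists_symp_matrix {K : Type*} [Field K] {k : ℕ}
    (S : Matrix (Fin k ⊕ Fin k) (Fin k ⊕ Fin k) K) (hS : Sᵀ = -S) (hd : ∀ i, S i i = 0)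
    (hdet : S.det ≠ 0) :
    ∃ Q : Matrix (Fin k ⊕ Fin k) (Fin k ⊕ Fin k) K, Q * S * Qᵀ = EE K k - (EE K k)ᵀ := by
  have hsk : ∀ i j, S i j = - S j i := fun i j => by
    have := congrFun (congrFun hS j) i
    simpa using this
  have hB : ∀ x y, Matrix.toLinearMap₂' K S x y = x ⬝ᵥ (S *ᵥ y) := fun x y =>
    Matrix.toLinearMap₂'_apply' S x y
  have hskew : ∀ x y : Fin k ⊕ Fin k → K, x ⬝ᵥ (S *ᵥ y) = - (y ⬝ᵥ (S *ᵥ x)) := by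
    intro x y
    rw [Matrix.dotProduct_mulVec, dotProduct_comm, ← Matrix.mulVec_transpose, hS,
      Matrix.neg_mulVec, dotProduct_neg]
  obtain ⟨e, f, he, hf, hef⟩ := exists_symp (K := K) k (Matrix.toLinearMap₂' K S)
    (by
      intro x
      rw [hB]
      simp only [dotProduct, Matrix.mulVec, Finset.mul_sum]
      rw [← Finset.sum_product']
      refine Finset.sum_involution (fun p _ => (p.2, p.1)) ?_ ?_ ?_ ?_
      · rintro ⟨i, j⟩ _
        simp only
        rw [hsk j i]; ring
      · rintro ⟨i, j⟩ _ h1 h2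
        simp only [Prod.mk.injEq] at h2
        apply h1
        simp [h2.1, hd]
      · intros; simp
      · intros; simp)
    (by
      intro x hx
      by_contra hne
      apply hdet
      rw [← Matrix.exists_vecMul_eq_zero_iff]
      refine ⟨x, hne, ?_⟩
      funext j
      have := hx (Pi.single j 1)
      rw [hB, Matrix.dotProduct_mulVec] at this
      simpa using this)
    (by simp [two_mul])
  simp only [hB] at he hf hef
  refine ⟨Matrix.of (Sum.elim e f), ?_⟩
  have ent : ∀ i j, (Matrix.of (Sum.elim e f) * S * (Matrix.of (Sum.elim e f))ᵀ) i j =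
      (Sum.elim e f i) ⬝ᵥ (S *ᵥ (Sum.elim e f j)) := by
    intro i j
    rw [Matrix.mul_assoc, Matrix.mul_apply]
    rfl
  ext i j
  rw [ent]
  rcases i with i | i <;> rcases j with j | j
  · simp [EE, he]
  · simp [EE, hef, Matrix.one_apply]
  · rw [hskew]; simp [EE, hef, Matrix.one_apply]
  · simp [EE, hf]

lemma hh_sq {K : Type*} [Field K] [CharZero K] {k : ℕ}
    (Y : Matrix (Fin k ⊕ Fin k) (Fin k ⊕ Fin k) K) :
    (hh (fun _ : Fin k => Y)) ^ 2 = (k.factorial : K) ^ 2 * (Y - Yᵀ).det := by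
  have hanti := hh_anti Y
  have h2 : (2 : K) ^ k ≠ 0 := pow_ne_zero _ two_ne_zero
  by_cases hdet : (Y - Yᵀ).det = 0
  · obtain ⟨v, hv, hvS⟩ := Matrix.exists_vecMul_eq_zero_iff.mpr hdet
    obtain ⟨i, hi⟩ : ∃ i, v i ≠ 0 := by
      by_contra hcon
      push Not at hcon
      exact hv (funext hcon)
    have hc := hh_conj ((1 : Matrix (Fin k ⊕ Fin k) (Fin k ⊕ Fin k) K).updateRow i v) (Y - Yᵀ)
    have hP : ((1 : Matrix (Fin k ⊕ Fin k) (Fin k ⊕ Fin k) K).updateRow i v).det = v i := by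
      rw [← Matrix.cramer_transpose_apply]
      simp
    have hrow : ∀ j, ((1 : Matrix (Fin k ⊕ Fin k) (Fin k ⊕ Fin k) K).updateRow i v * (Y - Yᵀ) *
        ((1 : Matrix (Fin k ⊕ Fin k) (Fin k ⊕ Fin k) K).updateRow i v)ᵀ) i j = 0 := by
      intro j
      have : ∀ l, ((1 : Matrix (Fin k ⊕ Fin k) (Fin k ⊕ Fin k) K).updateRow i v * (Y - Yᵀ)) i l
          = 0 := by
        intro l
        have := congrFun hvS l
        simpa [Matrix.mul_apply, Matrix.vecMul, dotProduct] using this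
      rw [Matrix.mul_apply]
      simp [this]
    have hcol : ∀ j, ((1 : Matrix (Fin k ⊕ Fin k) (Fin k ⊕ Fin k) K).updateRow i v * (Y - Yᵀ) *
        ((1 : Matrix (Fin k ⊕ Fin k) (Fin k ⊕ Fin k) K).updateRow i v)ᵀ) j i = 0 := by
      intro j
      set P := (1 : Matrix (Fin k ⊕ Fin k) (Fin k ⊕ Fin k) K).updateRow i v
      have ht : (P * (Y - Yᵀ) * Pᵀ)ᵀ = - (P * (Y - Yᵀ) * Pᵀ) := by
        simp only [Matrix.transpose_mul, Matrix.transpose_sub, Matrix.transpose_transpose]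
        rw [← Matrix.mul_assoc]
        rw [← neg_sub Y Yᵀ, Matrix.mul_neg, Matrix.neg_mul]
      have := congrFun (congrFun ht i) j
      rw [Matrix.transpose_apply, Matrix.neg_apply, hrow] at this
      simpa using this
    have hz : hh (fun _ : Fin k => (1 : Matrix (Fin k ⊕ Fin k) (Fin k ⊕ Fin k) K).updateRow i v *
        (Y - Yᵀ) * ((1 : Matrix (Fin k ⊕ Fin k) (Fin k ⊕ Fin k) K).updateRow i v)ᵀ) = 0 := by
      unfold hh
      refine Finset.sum_eq_zero fun σ _ => ?_
      rcases h : σ.symm i with a | a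
      · have h' : σ (Sum.inl a) = i := by rw [← h]; simp
        rw [Finset.prod_eq_zero (Finset.mem_univ a) (by rw [h']; exact hrow _), mul_zero]
      · have h' : σ (Sum.inr a) = i := by rw [← h]; simp
        rw [Finset.prod_eq_zero (Finset.mem_univ a) (by rw [h']; exact hcol _), mul_zero]
    rw [hz, hP, hanti] at hc
    have : hh (fun _ : Fin k => Y) = 0 := by
      have := hc.symm
      simpa [hi] using this
    rw [this, hdet]
    simp
  · obtain ⟨Q, hQ⟩ := exists_symp_matrix (Y - Yᵀ) (by simp) (by simp) hdet
    have h3 := hh_conj Q (Y - Yᵀ)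
    rw [hQ, hh_anti, hh_EE, hanti] at h3
    have h4 : (k.factorial : K) = Q.det * hh (fun _ : Fin k => Y) := by
      apply mul_left_cancel₀ h2
      rw [h3]; ring
    have h5 := congrArg Matrix.det hQ
    have h6 : (EE K k - (EE K k)ᵀ).det = 1 := by
      have e : EE K k - (EE K k)ᵀ = Matrix.fromBlocks 0 1 (-1) 0 := by
        rw [EE, Matrix.fromBlocks_transpose]
        ext i j
        rcases i with i | i <;> rcases j with j | j <;> simp
      have e2 : (Matrix.fromBlocks 0 1 (-1) 0 : Matrix (Fin k ⊕ Fin k) (Fin k ⊕ Fin k) K) *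
          Matrix.fromBlocks 1 0 1 1 = Matrix.fromBlocks 1 1 (-1) 0 := by
        simp [Matrix.fromBlocks_multiply]
      have e3 := congrArg Matrix.det e2
      rw [Matrix.det_mul, Matrix.det_fromBlocks_one₁₁, Matrix.det_fromBlocks_one₁₁] at e3
      rw [e]
      simpa using e3
    rw [h6, Matrix.det_mul, Matrix.det_mul, Matrix.det_transpose] at h5
    rw [h4]
    linear_combination (-(hh (fun _ : Fin k => Y))^2) * h5

lemma sum_incr {K : Type*} [CommRing K] {k n : ℕ} (G : (Fin k → Fin n) → K)
    (hG : ∀ f, ¬ Function.Injective f → G f = 0) :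
    ∑ f, G f = ∑ I ∈ incrFuns k n, ∑ σ : Equiv.Perm (Fin k), G (I ∘ σ) := by
  rw [← Finset.sum_product', eq_comm]
  have hmono : ∀ I ∈ incrFuns k n, StrictMono I := by
    intro I hI a b hab
    exact (Finset.mem_filter.mp hI).2 a b hab
  refine Finset.sum_of_injOn (fun p => p.1 ∘ p.2) ?_ ?_ ?_ ?_
  · rintro ⟨I, σ⟩ h1 ⟨I', σ'⟩ h2 h
    simp only [Finset.coe_product, Set.mem_prod, Finset.mem_coe] at h1 h2
    have hI := hmono I h1.1
    have hI' := hmono I' h2.1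
    simp only at h
    have hr : Set.range I = Set.range I' := by
      have := congrArg Set.range h
      rwa [Set.range_comp, Set.range_comp, σ.surjective.range_eq, σ'.surjective.range_eq,
        Set.image_univ, Set.image_univ] at this
    have hII : I = I' := (StrictMono.range_inj hI hI').mp hr
    subst hII
    have : σ = σ' := by
      ext a : 1
      exact hI.injective (congrFun h a)
    rw [this]
  · intro _ _; simp
  · intro f _ hf
    apply hG
    intro hinj
    apply hf
    refine ⟨(f ∘ Tuple.sort f, (Tuple.sort f)⁻¹), ?_, ?_⟩
    · simp only [Finset.coe_product, Set.mem_prod, Finset.mem_coe, Finset.mem_univ, and_true]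
      refine Finset.mem_filter.mpr ⟨Finset.mem_univ _, ?_⟩
      intro a b hab
      exact ((Tuple.monotone_sort f).strictMono_of_injective
        (hinj.comp (Tuple.sort f).injective)) hab
    · funext a
      simp
  · intro _ _; rfl

/-- The index equivalence. -/
def ee (k : ℕ) : Fin k ⊕ Fin k ≃ Fin (2 * k) :=
  finSumFinEquiv.trans (finCongr (two_mul k).symm)

lemma det_concat {K : Type*} [CommRing K] {k n : ℕ} (A : Matrix (Fin (2*k)) (Fin n) K)
    (p q : Fin k → Fin n) :
    (concatCB A A p q).det = ((A.submatrix (ee k) id).submatrix id (Sum.elim p q)).det := by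
  rw [← Matrix.det_submatrix_equiv_self (ee k)]
  congr 1
  ext i j
  rcases j with j | j <;> simp [concatCB, ee]

lemma det_perm {K : Type*} [CommRing K] {k : ℕ} {ν : Type*} (A : Matrix (Fin k ⊕ Fin k) ν K)
    (p q : Fin k → ν) (σ τ : Equiv.Perm (Fin k)) :
    (A.submatrix id (Sum.elim (p ∘ σ) (q ∘ τ))).det =
      ((Equiv.Perm.sign σ : ℤ) : K) * ((Equiv.Perm.sign τ : ℤ) : K) *
        (A.submatrix id (Sum.elim p q)).det := by
  have h := Matrix.det_permute' (Equiv.Perm.sumCongr σ τ) (A.submatrix id (Sum.elim p q))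
  rw [Equiv.Perm.sign_sumCongr] at h
  push_cast at h
  rw [← h]
  congr 1
  ext i j
  rcases j with j | j <;> simp

lemma fact_f {K : Type*} [CommRing K] {k n : ℕ} (A : Matrix (Fin (2*k)) (Fin n) K)
    (X : Matrix (Fin n) (Fin n) K) :
    hh (fun _ : Fin k => A.submatrix (ee k) id * X * (A.submatrix (ee k) id)ᵀ) =
      (k.factorial : K) * fAB A A X := by
  rw [hh_expand]
  set A' := A.submatrix (ee k) id with hA'
  have hz1 : ∀ p q : Fin k → Fin n, ¬ Function.Injective p →
      (A'.submatrix id (Sum.elim p q)).det = 0 := by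
    intro p q hp
    simp only [Function.Injective, not_forall] at hp
    obtain ⟨a, b, hab, hne⟩ := hp
    refine Matrix.det_zero_of_column_eq (i := Sum.inl a) (j := Sum.inl b) (by simpa using hne) ?_
    intro i
    simp [hab]
  have hz2 : ∀ p q : Fin k → Fin n, ¬ Function.Injective q →
      (A'.submatrix id (Sum.elim p q)).det = 0 := by
    intro p q hp
    simp only [Function.Injective, not_forall] at hp
    obtain ⟨a, b, hab, hne⟩ := hp
    refine Matrix.det_zero_of_column_eq (i := Sum.inr a) (j := Sum.inr b) (by simpa using hne) ?_
    intro i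
    simp [hab]
  rw [sum_incr]
  swap
  · intro p hp
    exact Finset.sum_eq_zero fun q _ => by rw [hz1 p q hp, mul_zero]
  unfold fAB
  rw [Finset.mul_sum]
  refine Finset.sum_congr rfl fun I _ => ?_
  have : ∀ σ : Equiv.Perm (Fin k), ∑ q : Fin k → Fin n, (∏ a, X ((I ∘ σ) a) (q a)) *
      (A'.submatrix id (Sum.elim (I ∘ σ) q)).det = ∑ J ∈ incrFuns k n, ∑ τ : Equiv.Perm (Fin k),
      (∏ a, X ((I ∘ σ) a) ((J ∘ τ) a)) * (A'.submatrix id (Sum.elim (I ∘ σ) (J ∘ τ))).det := by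
    intro σ
    rw [sum_incr]
    intro q hq
    rw [hz2 _ q hq, mul_zero]
  simp only [this]
  rw [Finset.sum_comm, Finset.mul_sum]
  refine Finset.sum_congr rfl fun J _ => ?_
  rw [Finset.sum_comm, det_concat, ← hA']
  have h2 : ∀ τ : Equiv.Perm (Fin k), ∑ σ : Equiv.Perm (Fin k),
      (∏ a, X ((I ∘ σ) a) ((J ∘ τ) a)) * (A'.submatrix id (Sum.elim (I ∘ σ) (J ∘ τ))).det =
      (X.submatrix I J).det * (A'.submatrix id (Sum.elim I J)).det := by
    intro τ
    rw [Matrix.det_apply', Finset.sum_mul, ← Equiv.sum_comp (Equiv.mulRight τ)]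
    refine Finset.sum_congr rfl fun σ _ => ?_
    rw [det_perm]
    simp only [Equiv.coe_mulRight, Function.comp, Equiv.Perm.mul_apply, Matrix.submatrix_apply,
      Equiv.Perm.sign_mul]
    rw [Equiv.prod_comp τ (fun a => X (I (σ a)) (J a))]
    have hs : ((Equiv.Perm.sign τ : ℤ) : K) * ((Equiv.Perm.sign τ : ℤ) : K) = 1 := by
      rw [← Int.cast_mul, ← Units.val_mul, Int.units_mul_self]
      simp
    push_cast
    linear_combination ((Equiv.Perm.sign σ : ℤ) : K) * (∏ a, X (I (σ a)) (J a)) *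
      (A'.submatrix id (Sum.elim I J)).det * hs
  simp only [h2]
  simp [Fintype.card_perm]

lemma det_skew_add {K : Type*} [Field K] [CharZero K] {k : ℕ}
    (S : Matrix (Fin (2*k)) (Fin (2*k)) K) (hS : Sᵀ = -S) (U : Matrix (Fin (2*k)) Unit K) :
    (S + U * Uᵀ).det = S.det := by
  have h0 : (Matrix.fromBlocks S U (-Uᵀ) (0 : Matrix Unit Unit K)).det = 0 := by
    have h1 : (Matrix.fromBlocks S U (-Uᵀ) (0 : Matrix Unit Unit K))ᵀ =
        -(Matrix.fromBlocks S U (-Uᵀ) (0 : Matrix Unit Unit K)) := by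
      rw [Matrix.fromBlocks_transpose, Matrix.fromBlocks_neg, hS]
      simp
    have h2 := congrArg Matrix.det h1
    rw [Matrix.det_transpose, Matrix.det_neg] at h2
    have h3 : (-1 : K) ^ Fintype.card (Fin (2 * k) ⊕ Unit) = -1 := by
      apply Odd.neg_one_pow
      simp
    rw [h3] at h2
    apply self_eq_neg.mp
    linear_combination h2
  have h1 : (Matrix.fromBlocks S U (-Uᵀ) (1 : Matrix Unit Unit K)) =
      (Matrix.fromBlocks S U (-Uᵀ) (0 : Matrix Unit Unit K)).updateRow (Sum.inr ())
        ((Sum.elim (fun j => -U j ()) 0 : Fin (2 * k) ⊕ Unit → K) + (Sum.elim 0 1 : Fin (2 * k) ⊕ Unit → K)) := by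
    ext i j
    rcases i with i | i <;> rcases j with j | j <;> simp [Matrix.updateRow_apply]
  have h2 : (Matrix.fromBlocks S U (-Uᵀ) (0 : Matrix Unit Unit K)).updateRow (Sum.inr ())
        ((Sum.elim (fun j => -U j ()) 0)) = Matrix.fromBlocks S U (-Uᵀ) (0 : Matrix Unit Unit K) := by
    ext i j
    rcases i with i | i <;> rcases j with j | j <;> simp [Matrix.updateRow_apply]
  have h3 : (Matrix.fromBlocks S U (-Uᵀ) (0 : Matrix Unit Unit K)).updateRow (Sum.inr ())
        (Sum.elim 0 1) = Matrix.fromBlocks S U 0 (1 : Matrix Unit Unit K) := by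
    ext i j
    rcases i with i | i <;> rcases j with j | j <;> simp [Matrix.updateRow_apply]
  have h4 := congrArg Matrix.det h1
  rw [Matrix.det_updateRow_add, h2, h3, h0, Matrix.det_fromBlocks_zero₂₁,
    Matrix.det_fromBlocks_one₂₂] at h4
  simpa using h4

lemma main_field {K : Type*} [Field K] [CharZero K] (k n : ℕ)
    (A : Matrix (Fin (2*k)) (Fin n) K) (X : Matrix (Fin n) (Fin n) K) :
    (A * (X + allOnes K n - Xᵀ) * Aᵀ).det = (A * (X - Xᵀ) * Aᵀ).det ∧
      (A * (X - Xᵀ) * Aᵀ).det = (fAB A A X) ^ 2 := by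
  constructor
  · have hJ : allOnes K n = (Matrix.of fun _ _ => 1 : Matrix (Fin n) Unit K) *
        (Matrix.of fun _ _ => 1 : Matrix (Fin n) Unit K)ᵀ := by
      ext i j
      simp [allOnes, Matrix.mul_apply]
    have : A * (X + allOnes K n - Xᵀ) * Aᵀ = A * (X - Xᵀ) * Aᵀ +
        (A * (Matrix.of fun _ _ => 1 : Matrix (Fin n) Unit K)) *
        (A * (Matrix.of fun _ _ => 1 : Matrix (Fin n) Unit K))ᵀ := by
      rw [hJ, Matrix.transpose_mul]
      simp only [Matrix.mul_add, Matrix.mul_sub, Matrix.add_mul, Matrix.sub_mul, Matrix.mul_assoc]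
      abel
    rw [this, det_skew_add]
    simp only [Matrix.transpose_mul, Matrix.transpose_sub, Matrix.transpose_transpose]
    rw [← Matrix.mul_assoc, ← neg_sub X Xᵀ, Matrix.mul_neg, Matrix.neg_mul]
  · have h1 := hh_sq (A.submatrix (ee k) id * X * (A.submatrix (ee k) id)ᵀ)
    rw [fact_f, mul_pow] at h1
    have hf : (k.factorial : K) ^ 2 ≠ 0 := pow_ne_zero _ (by exact_mod_cast k.factorial_ne_zero)
    have h2 := mul_left_cancel₀ hf h1
    rw [h2, ← Matrix.det_submatrix_equiv_self (ee k)]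
    congr 1
    rw [Matrix.transpose_mul, Matrix.transpose_mul, Matrix.transpose_transpose, ← Matrix.mul_assoc,
      ← Matrix.sub_mul, ← Matrix.mul_sub]
    ext i j
    simp [Matrix.mul_apply]

lemma map_fAB {R S : Type*} [CommRing R] [CommRing S] (φ : R →+* S) {k n : ℕ}
    (A : Matrix (Fin (2*k)) (Fin n) R) (X : Matrix (Fin n) (Fin n) R) :
    φ (fAB A A X) = fAB (A.map φ) (A.map φ) (X.map φ) := by
  unfold fAB
  simp only [map_sum, map_mul, RingHom.map_det]
  refine Finset.sum_congr rfl fun I _ => Finset.sum_congr rfl fun J _ => ?_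
  congr 2
  ext i j
  simp only [concatCB, RingHom.mapMatrix_apply, Matrix.map_apply, Matrix.of_apply]
  split_ifs <;> rfl

lemma map_det1 {R S : Type*} [CommRing R] [CommRing S] (φ : R →+* S) {k n : ℕ}
    (A : Matrix (Fin (2*k)) (Fin n) R) (X : Matrix (Fin n) (Fin n) R) :
    φ (A * X * Aᵀ).det = ((A.map φ) * (X.map φ) * (A.map φ)ᵀ).det := by
  rw [RingHom.map_det, RingHom.mapMatrix_apply, Matrix.map_mul, Matrix.map_mul, Matrix.transpose_map]

lemma map_X1 {R S : Type*} [CommRing R] [CommRing S] (φ : R →+* S) {n : ℕ}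
    (X : Matrix (Fin n) (Fin n) R) :
    (X + allOnes R n - Xᵀ).map φ = X.map φ + allOnes S n - (X.map φ)ᵀ := by
  ext i j; simp [allOnes]

lemma map_X2 {R S : Type*} [CommRing R] [CommRing S] (φ : R →+* S) {n : ℕ}
    (X : Matrix (Fin n) (Fin n) R) :
    (X - Xᵀ).map φ = X.map φ - (X.map φ)ᵀ := by
  ext i j; simp

lemma main_domain {R : Type*} [CommRing R] [IsDomain R] [CharZero R] (k n : ℕ)
    (A : Matrix (Fin (2*k)) (Fin n) R) (X : Matrix (Fin n) (Fin n) R) :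
    (A * (X + allOnes R n - Xᵀ) * Aᵀ).det = (A * (X - Xᵀ) * Aᵀ).det ∧
      (A * (X - Xᵀ) * Aᵀ).det = (fAB A A X) ^ 2 := by
  have hinj := IsFractionRing.injective R (FractionRing R)
  have : CharZero (FractionRing R) := charZero_of_injective_algebraMap hinj
  have h := main_field k n (A.map (algebraMap R (FractionRing R)))
    (X.map (algebraMap R (FractionRing R)))
  rw [← map_X1, ← map_X2, ← map_det1, ← map_det1, ← map_fAB, ← map_pow] at h
  exact ⟨hinj h.1, hinj h.2⟩

/-- Corollary: for `m = 2k` even,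
`det(A·(X + 𝒥 − Xᵗ)·Aᵗ) = det(A·(X − Xᵗ)·Aᵗ) = (f_A(X))²`. -/
theorem det_symm_case_even {R : Type*} [CommRing R] (k n : ℕ) (hk : 0 < k) (hn : 0 < n)
    (A : Matrix (Fin (2*k)) (Fin n) R) (X : Matrix (Fin n) (Fin n) R) :
    (A * (X + allOnes R n - Xᵀ) * Aᵀ).det = (A * (X - Xᵀ) * Aᵀ).det ∧
      (A * (X - Xᵀ) * Aᵀ).det = (fAB A A X) ^ 2 := by
  let σ := (Fin (2*k) × Fin n) ⊕ (Fin n × Fin n)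
  let A0 : Matrix (Fin (2*k)) (Fin n) (MvPolynomial σ ℤ) :=
    Matrix.of fun i j => MvPolynomial.X (Sum.inl (i, j))
  let X0 : Matrix (Fin n) (Fin n) (MvPolynomial σ ℤ) :=
    Matrix.of fun i j => MvPolynomial.X (Sum.inr (i, j))
  let φ : MvPolynomial σ ℤ →+* R := MvPolynomial.eval₂Hom (Int.castRingHom R)
    (Sum.elim (fun p => A p.1 p.2) (fun p => X p.1 p.2))
  have hA : A0.map φ = A := by
    ext i j
    simp [A0, φ]
  have hX : X0.map φ = X := by
    ext i j
    simp [X0, φ]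
  have h := main_domain k n A0 X0
  have h1 := congrArg φ h.1
  have h2 := congrArg φ h.2
  rw [map_det1, map_det1, map_X1, map_X2, hA, hX] at h1
  rw [map_pow, map_det1, map_X2, map_fAB, hA, hX] at h2
  exact ⟨h1, h2⟩
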